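/- arXiv:1808.10484 — 4 statements merged into one kernel-verified Lean document; each statement's English description precedes it below -/
import Mathlib

section
/- Fix a quadratic refinement Q₀ of β. Then the map sending a linear functional a : V →ₗ[ZMod 2] ZMod 2 to the function (fun x => Q₀ x + e (a x)) is a bijection from the dual space Module.Dual (ZMod 2) V onto the set of all quadratic refinements of β. (This is the paper's assertion that the quadratic functions on a fixed manifold form a torsor over H^1(M; Z/2), in its linear-algebra form.) -/
/-- `Q : V → ZMod 4` is a quadratic refinement of the symmetric bilinear form `β`,
where `e : ZMod 2 →+ ZMod 4` is the unique injective additive homomorphism. -/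
def IsQuadraticRefinement {V : Type*} [AddCommGroup V] [Module (ZMod 2) V]
    (β : V →ₗ[ZMod 2] V →ₗ[ZMod 2] ZMod 2)
    (e : ZMod 2 →+ ZMod 4) (Q : V → ZMod 4) : Prop :=
  ∀ x y : V, Q (x + y) = Q x + Q y + e (β x y)

/-- An additive map from a `ZMod 2`-module to `ZMod 4` factors through
the injective additive map `e : ZMod 2 →+ ZMod 4`, by a linear functional. -/
theorem exists_dual_eq_of_addMonoidHom {V : Type*} [AddCommGroup V] [Module (ZMod 2) V]
    (e : ZMod 2 →+ ZMod 4) (he : Function.Injective e) (he1 : e 1 = 2) (d : V →+ ZMod 4) :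
    ∃ a : Module.Dual (ZMod 2) V, ∀ x, e (a x) = d x := by
  have h_range (x : V) : ∃ t, e t = d x := by
    have hx : d x + d x = 0 := by
      rw [← map_add, ZModModule.add_self, map_zero]
    have h_two_torsion : ∀ z : ZMod 4, z + z = 0 → z = 0 ∨ z = 2 := by decide
    rcases h_two_torsion _ hx with h | h
    · exact ⟨0, by rw [h, map_zero]⟩
    · exact ⟨1, by rw [h, he1]⟩
  choose a ha using h_range
  have ha_add (x y : V) : a (x + y) = a x + a y := he (by simp only [ha, map_add])
  exact ⟨(AddMonoidHom.mk' a ha_add).toZModLinearMap 2, ha⟩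

theorem quadraticRefinements_torsor_over_dual
    {V : Type*} [AddCommGroup V] [Module (ZMod 2) V]
    (β : V →ₗ[ZMod 2] V →ₗ[ZMod 2] ZMod 2) (hβ : ∀ x y : V, β x y = β y x)
    (e : ZMod 2 →+ ZMod 4) (he : Function.Injective e) (he1 : e 1 = 2)
    (Q₀ : V → ZMod 4) (hQ₀ : IsQuadraticRefinement β e Q₀) :
    Set.BijOn (fun (a : Module.Dual (ZMod 2) V) => (fun x : V => Q₀ x + e (a x)))
      Set.univ {Q : V → ZMod 4 | IsQuadraticRefinement β e Q} := by
  refine ⟨fun a _ x y => ?_, fun a _ b _ hab => ?_, fun Q hQ => ?_⟩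
  · simp only [hQ₀ x y, map_add]
    abel
  · ext x
    exact he (add_left_cancel (congrFun hab x))
  · obtain ⟨a, ha⟩ := exists_dual_eq_of_addMonoidHom e he he1
      (AddMonoidHom.mk' (fun x => Q x - Q₀ x) fun x y => by
        rw [hQ x y, hQ₀ x y]
        abel)
    refine ⟨a, Set.mem_univ a, funext fun x => ?_⟩
    simp [ha]
end

section
/- If V is finite-dimensional of dimension n over ZMod 2, then the set of quadratic refinements of β is nonempty, finite, and has exactly 2 ^ n elements. -/
/-- The set-theoretic lift of `0, 1 : ZMod 2` to `0, 1 : ZMod 4`. -/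
def liftZMod4 (a : ZMod 2) : ZMod 4 := (a.val : ZMod 4)

lemma liftZMod4_add (a b : ZMod 2) :
    liftZMod4 (a + b) = liftZMod4 a + liftZMod4 b + 2 * (liftZMod4 a * liftZMod4 b) := by
  revert a b; decide

lemma liftZMod4_mul (a b : ZMod 2) : liftZMod4 (a * b) = liftZMod4 a * liftZMod4 b := by
  revert a b; decide

lemma apply_eq_two_mul_liftZMod4 {e : ZMod 2 →+ ZMod 4} (he1 : e 1 = 2) (a : ZMod 2) :
    e a = 2 * liftZMod4 a := by
  fin_cases a
  · exact (map_zero e).trans (by decide)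
  · exact he1.trans (by decide)

/-- A symmetric bilinear form over `ZMod 4`, evaluated on the diagonal, is insensitive to
changing its argument by a multiple of `2`. -/
lemma bilin_diag_add_two_smul {M : Type*} [AddCommGroup M] [Module (ZMod 4) M]
    (S : M →ₗ[ZMod 4] M →ₗ[ZMod 4] ZMod 4) (hS : ∀ u v, S u v = S v u) (u v w : M) :
    S (u + v + (2 : ZMod 4) • w) (u + v + (2 : ZMod 4) • w) = S u u + S v v + 2 * S u v := by
  have h4 : (4 : ZMod 4) = 0 := by decide
  simp only [map_add, map_smul, LinearMap.add_apply, LinearMap.smul_apply, smul_eq_mul]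
  rw [hS w u, hS w v, hS v u]
  linear_combination (S u w + S v w + S w w) * h4

lemma exists_isQuadraticRefinement {V : Type*} [AddCommGroup V] [Module (ZMod 2) V]
    [FiniteDimensional (ZMod 2) V]
    (β : V →ₗ[ZMod 2] V →ₗ[ZMod 2] ZMod 2) (hβ : ∀ x y : V, β x y = β y x)
    {e : ZMod 2 →+ ZMod 4} (he1 : e 1 = 2) :
    ∃ Q : V → ZMod 4, IsQuadraticRefinement β e Q := by
  let b := Module.finBasis (ZMod 2) V
  let S : (Fin (Module.finrank (ZMod 2) V) → ZMod 4) →ₗ[ZMod 4]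
      (Fin (Module.finrank (ZMod 2) V) → ZMod 4) →ₗ[ZMod 4] ZMod 4 :=
    Matrix.toLinearMap₂' (ZMod 4) (Matrix.of fun i j => liftZMod4 (β (b i) (b j)))
  have hSapply (u v) : S u v = ∑ i, ∑ j, u i * v j * liftZMod4 (β (b i) (b j)) := by
    simp [S, Matrix.toLinearMap₂'_apply, mul_assoc]
  have hS (u v) : S u v = S v u := by
    rw [hSapply, hSapply, Finset.sum_comm]
    refine Finset.sum_congr rfl fun i _ => Finset.sum_congr rfl fun j _ => ?_
    rw [hβ, mul_comm (u j)]
  let l : V → Fin (Module.finrank (ZMod 2) V) → ZMod 4 := fun x i => liftZMod4 (b.repr x i)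
  refine ⟨fun x => S (l x) (l x), fun x y => ?_⟩
  have hl : l (x + y) = l x + l y + (2 : ZMod 4) • (l x * l y) := by
    ext i
    simp [l, liftZMod4_add]
  have hcross : 2 * S (l x) (l y) = e (β x y) := by
    have hβsum : β x y = ∑ i, ∑ j, b.repr x i * (b.repr y j * β (b i) (b j)) := by
      conv_lhs => rw [← b.sum_repr x, ← b.sum_repr y]
      simp only [map_sum, map_smul, LinearMap.sum_apply, LinearMap.smul_apply, smul_eq_mul,
        Finset.mul_sum]
      rw [Finset.sum_comm]
      simp only [mul_left_comm]
    rw [hβsum]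
    simp only [map_sum]
    simp only [hSapply, Finset.mul_sum, apply_eq_two_mul_liftZMod4 he1, liftZMod4_mul, l, mul_assoc]
  simp only [hl, bilin_diag_add_two_smul S hS, hcross]

lemma mem_range_of_two_mul_eq_zero {e : ZMod 2 →+ ZMod 4} (he1 : e 1 = 2) {a : ZMod 4}
    (ha : a + a = 0) : ∃ c, e c = a := by
  have h : a = 0 ∨ a = 2 := by revert a; decide
  rcases h with rfl | rfl
  exacts [⟨0, map_zero e⟩, ⟨1, he1⟩]

/-- Quadratic refinements of `β` form a torsor under the dual space of `V`. -/
lemma setOf_isQuadraticRefinement_eq_range {V : Type*} [AddCommGroup V] [Module (ZMod 2) V]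
    {β : V →ₗ[ZMod 2] V →ₗ[ZMod 2] ZMod 2} {e : ZMod 2 →+ ZMod 4}
    (he : Function.Injective e) (he1 : e 1 = 2)
    {Q₀ : V → ZMod 4} (hQ₀ : IsQuadraticRefinement β e Q₀) :
    {Q : V → ZMod 4 | IsQuadraticRefinement β e Q} =
      Set.range fun (f : Module.Dual (ZMod 2) V) x => Q₀ x + e (f x) := by
  ext Q
  constructor
  · intro hQ
    have hadd (x y : V) : Q (x + y) - Q₀ (x + y) = (Q x - Q₀ x) + (Q y - Q₀ y) := by
      rw [hQ x y, hQ₀ x y]; ring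
    have hzero : Q 0 - Q₀ 0 = 0 := by simpa using hadd 0 0
    have htwo (x : V) : (Q x - Q₀ x) + (Q x - Q₀ x) = 0 := by
      rw [← hadd, ZModModule.add_self, hzero]
    choose f hf using fun x => mem_range_of_two_mul_eq_zero he1 (htwo x)
    let F : V →+ ZMod 2 := AddMonoidHom.mk' f fun x y => he (by
      rw [map_add, hf, hf, hf, hadd])
    refine ⟨F.toZModLinearMap 2, funext fun x => ?_⟩
    change Q₀ x + e (f x) = Q x
    rw [hf]; ring
  · rintro ⟨f, rfl⟩ x y
    simp only [map_add, hQ₀ x y]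
    ring

theorem card_quadraticRefinements
    {V : Type*} [AddCommGroup V] [Module (ZMod 2) V]
    (β : V →ₗ[ZMod 2] V →ₗ[ZMod 2] ZMod 2) (hβ : ∀ x y : V, β x y = β y x)
    (e : ZMod 2 →+ ZMod 4) (he : Function.Injective e) (he1 : e 1 = 2)
    (n : ℕ) [FiniteDimensional (ZMod 2) V]
    (hn : Module.finrank (ZMod 2) V = n) :
    {Q : V → ZMod 4 | IsQuadraticRefinement β e Q}.Nonempty ∧
    {Q : V → ZMod 4 | IsQuadraticRefinement β e Q}.Finite ∧
    {Q : V → ZMod 4 | IsQuadraticRefinement β e Q}.ncard = 2 ^ n := by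
  obtain ⟨Q₀, hQ₀⟩ := exists_isQuadraticRefinement β hβ he1
  refine ⟨⟨Q₀, hQ₀⟩, ?_⟩
  have : Finite (Module.Dual (ZMod 2) V) := Module.finite_of_finite (ZMod 2)
  rw [setOf_isQuadraticRefinement_eq_range he he1 hQ₀]
  refine ⟨Set.finite_range _, ?_⟩
  have hinj : Function.Injective fun (f : Module.Dual (ZMod 2) V) x => Q₀ x + e (f x) :=
    fun f g hfg => LinearMap.ext fun x => he (add_left_cancel (congrFun hfg x))
  rw [← Nat.card_coe_set_eq, Nat.card_range_of_injective hinj,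
    Module.natCard_eq_pow_finrank (K := ZMod 2), Subspace.dual_finrank_eq, hn, Nat.card_zmod]
end

section
/- The assignment sending an ℝ/ℤ-valued quadratic refinement Q of β to the map L_Q : G'_β → AddCircle ℝ ℤ defined by L_Q (w, p) = w + Q p is a bijection from the set of ℝ/ℤ-valued quadratic refinements of β onto the set of additive group homomorphisms L : G'_β →+ AddCircle ℝ ℤ satisfying L (w, 0) = w for all w : AddCircle ℝ ℤ. (This is the abstract form of the paper's Claim 3.1: quadratic functions on an oriented Spin manifold M correspond bijectively to linear functions on G^{spin}_n(M, ∂M) that restrict to ∫ w on the subgroup of pairs (w, 0).) -/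
variable {V : Type*} [AddCommGroup V] [Module (ZMod 2) V]

theorem add_self_V (x : V) : x + x = 0 := by
  calc x + x = (1 : ZMod 2) • x + (1 : ZMod 2) • x := by rw [one_smul]
    _ = ((1 : ZMod 2) + 1) • x := (add_smul _ _ _).symm
    _ = (0 : ZMod 2) • x := by rw [show (1 : ZMod 2) + 1 = 0 from by decide]
    _ = 0 := zero_smul _ _

/-- The group `G'_β` of the paper: underlying set `(ℝ/ℤ) × V` with twisted addition
`(w, p) + (v, q) = (w + v + h (β p q), p + q)`, where `h : ZMod 2 →+ ℝ/ℤ`. -/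
@[ext]
structure GSpin (h : ZMod 2 →+ AddCircle (1 : ℝ))
    (β : V →ₗ[ZMod 2] V →ₗ[ZMod 2] ZMod 2)
    (hβ : ∀ x y : V, β x y = β y x) where
  w : AddCircle (1 : ℝ)
  p : V

namespace GSpin

variable {h : ZMod 2 →+ AddCircle (1 : ℝ)}
  {β : V →ₗ[ZMod 2] V →ₗ[ZMod 2] ZMod 2} {hβ : ∀ x y : V, β x y = β y x}

noncomputable instance : Add (GSpin h β hβ) :=
  ⟨fun a b => ⟨a.w + b.w + h (β a.p b.p), a.p + b.p⟩⟩
noncomputable instance : Zero (GSpin h β hβ) := ⟨⟨0, 0⟩⟩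
noncomputable instance : Neg (GSpin h β hβ) := ⟨fun a => ⟨-a.w + h (β a.p a.p), a.p⟩⟩

theorem add_def (a b : GSpin h β hβ) :
    a + b = ⟨a.w + b.w + h (β a.p b.p), a.p + b.p⟩ := rfl
theorem zero_def : (0 : GSpin h β hβ) = ⟨0, 0⟩ := rfl
theorem neg_def (a : GSpin h β hβ) : -a = ⟨-a.w + h (β a.p a.p), a.p⟩ := rfl

theorem gadd_assoc (a b c : GSpin h β hβ) : a + b + c = a + (b + c) := by
  ext
  · simp only [add_def, map_add, LinearMap.add_apply]
    abel
  · simp only [add_def]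
    exact add_assoc _ _ _

theorem gzero_add (a : GSpin h β hβ) : 0 + a = a := by
  ext <;> simp [add_def, zero_def]

theorem gadd_zero (a : GSpin h β hβ) : a + 0 = a := by
  ext <;> simp [add_def, zero_def]

theorem gadd_comm (a b : GSpin h β hβ) : a + b = b + a := by
  ext
  · simp only [add_def]
    rw [hβ b.p a.p]
    abel
  · simp only [add_def]
    exact add_comm _ _

theorem gneg_add_cancel (a : GSpin h β hβ) : -a + a = 0 := by
  ext
  · simp only [add_def, neg_def, zero_def]
    have hz : h (β a.p a.p) + h (β a.p a.p) = 0 := by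
      rw [← map_add, show β a.p a.p + β a.p a.p = 0 from by
        generalize β a.p a.p = u; revert u; decide, map_zero]
    have hrw : -a.w + h (β a.p a.p) + a.w + h (β a.p a.p)
        = (h (β a.p a.p) + h (β a.p a.p)) + (-a.w + a.w) := by abel
    rw [hrw, hz, neg_add_cancel, add_zero]
  · simp only [add_def, neg_def, zero_def]
    exact add_self_V _

noncomputable instance : AddCommGroup (GSpin h β hβ) where
  add := (· + ·)
  zero := 0
  neg := Neg.neg
  add_assoc := gadd_assoc
  zero_add := gzero_add
  add_zero := gadd_zero
  add_comm := gadd_comm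
  neg_add_cancel := gneg_add_cancel
  nsmul := nsmulRec
  zsmul := zsmulRec

end GSpin

/-- `Q : V → ℝ/ℤ` is an ℝ/ℤ-valued quadratic refinement of the symmetric bilinear
form `β`, where `h : ZMod 2 →+ ℝ/ℤ` is the unique injective additive homomorphism. -/
def IsQuadraticRefinementC (β : V →ₗ[ZMod 2] V →ₗ[ZMod 2] ZMod 2)
    (h : ZMod 2 →+ AddCircle (1 : ℝ)) (Q : V → AddCircle (1 : ℝ)) : Prop :=
  ∀ x y : V, Q (x + y) = Q x + Q y + h (β x y)

/-- Claim 3.1 of the paper (abstract form): `Q ↦ L_Q` with `L_Q (w, p) = w + Q p` is a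
bijection from ℝ/ℤ-valued quadratic refinements of `β` onto additive group
homomorphisms `L : G'_β → ℝ/ℤ` with `L (w, 0) = w`. -/
theorem circle_quadraticRefinements_equiv_linear_functions_on_GSpin
    (β : V →ₗ[ZMod 2] V →ₗ[ZMod 2] ZMod 2) (hβ : ∀ x y : V, β x y = β y x)
    (h : ZMod 2 →+ AddCircle (1 : ℝ)) (hinj : Function.Injective h)
    (h1 : h 1 = ((1 / 2 : ℝ) : AddCircle (1 : ℝ))) :
    Set.BijOn
      (fun (Q : V → AddCircle (1 : ℝ)) => (fun a : GSpin h β hβ => a.w + Q a.p))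
      {Q : V → AddCircle (1 : ℝ) | IsQuadraticRefinementC β h Q}
      {L : GSpin h β hβ → AddCircle (1 : ℝ) |
        (∀ a b : GSpin h β hβ, L (a + b) = L a + L b) ∧
        ∀ w : AddCircle (1 : ℝ), L ⟨w, 0⟩ = w} := by
  have hh (c : ZMod 2) : h c + h c = 0 := by
    rw [← map_add, CharTwo.add_self_eq_zero, map_zero]
  refine ⟨fun Q hQ => ⟨fun a b => ?_, fun w => ?_⟩, fun Q _ Q' _ hQQ' => ?_, ?_⟩
  · have hab : Q (a.p + b.p) = Q a.p + Q b.p + h (β a.p b.p) := hQ a.p b.p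
    simp only [GSpin.add_def, hab]
    calc _ = a.w + Q a.p + (b.w + Q b.p) + (h (β a.p b.p) + h (β a.p b.p)) := by abel
      _ = _ := by rw [hh, add_zero]
  · have h0 : Q (0 + 0) = Q 0 + Q 0 + h (β 0 0) := hQ 0 0
    simpa using h0
  · funext p
    simpa using congrFun hQQ' ⟨0, p⟩
  · rintro L ⟨hadd, hL⟩
    have split (w : AddCircle (1 : ℝ)) (p : V) : L ⟨w, p⟩ = w + L ⟨0, p⟩ := by
      have hwp := hadd ⟨w, 0⟩ ⟨0, p⟩
      simpa [GSpin.add_def, hL] using hwp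
    refine ⟨fun p => L ⟨0, p⟩, fun x y => ?_, funext fun a => (split a.w a.p).symm⟩
    have hxy := hadd ⟨0, x⟩ ⟨0, y⟩
    simp only [GSpin.add_def, zero_add] at hxy
    rw [split] at hxy
    change L ⟨0, x + y⟩ = L ⟨0, x⟩ + L ⟨0, y⟩ + h (β x y)
    rw [← hxy, add_right_comm, hh, zero_add]
end

section
/- Suppose V is finite-dimensional of dimension n over ZMod 2. If there exists x₀ : V with β x₀ x₀ = 1, then G_β is isomorphic as an additive group to (ZMod 4) × (Fin (n − 1) → ZMod 2); if instead β x x = 0 for all x : V, then every element of G_β has additive order dividing 2, and G_β is isomorphic as an additive group to (Fin (n + 1) → ZMod 2). (This is the abstract form of the paper's statement in §6.5 that G^{pin}_2(E², ∂E²) for a surface is a direct sum of Z/2's and Z/4's, with the number of Z/4's equal to the rank of the linear map x ↦ x² : H^1(E², ∂E²; Z/2) → Z/2.) -/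
variable {V : Type*} [AddCommGroup V] [Module (ZMod 2) V]

/-- The group `G_β` of the paper: underlying set `(ZMod 2) × V` with twisted addition
`(w, p) + (v, q) = (w + v + β p q, p + q)`. -/
@[ext]
structure GPin (β : V →ₗ[ZMod 2] V →ₗ[ZMod 2] ZMod 2)
    (hβ : ∀ x y : V, β x y = β y x) where
  w : ZMod 2
  p : V

namespace GPin

variable {β : V →ₗ[ZMod 2] V →ₗ[ZMod 2] ZMod 2} {hβ : ∀ x y : V, β x y = β y x}

theorem add_self_V (x : V) : x + x = 0 := by
  calc x + x = (1 : ZMod 2) • x + (1 : ZMod 2) • x := by rw [one_smul]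
    _ = ((1 : ZMod 2) + 1) • x := (add_smul _ _ _).symm
    _ = (0 : ZMod 2) • x := by rw [show (1 : ZMod 2) + 1 = 0 from by decide]
    _ = 0 := zero_smul _ _

instance : Add (GPin β hβ) := ⟨fun a b => ⟨a.w + b.w + β a.p b.p, a.p + b.p⟩⟩
instance : Zero (GPin β hβ) := ⟨⟨0, 0⟩⟩
instance : Neg (GPin β hβ) := ⟨fun a => ⟨a.w + β a.p a.p, a.p⟩⟩

theorem add_def (a b : GPin β hβ) :
    a + b = ⟨a.w + b.w + β a.p b.p, a.p + b.p⟩ := rfl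
theorem zero_def : (0 : GPin β hβ) = ⟨0, 0⟩ := rfl
theorem neg_def (a : GPin β hβ) : -a = ⟨a.w + β a.p a.p, a.p⟩ := rfl

theorem gadd_assoc (a b c : GPin β hβ) : a + b + c = a + (b + c) := by
  ext
  · simp only [add_def, map_add, LinearMap.add_apply]
    ring
  · simp only [add_def]
    exact add_assoc _ _ _

theorem gzero_add (a : GPin β hβ) : 0 + a = a := by
  ext <;> simp [add_def, zero_def]

theorem gadd_zero (a : GPin β hβ) : a + 0 = a := by
  ext <;> simp [add_def, zero_def]

theorem gadd_comm (a b : GPin β hβ) : a + b = b + a := by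
  ext
  · simp only [add_def]
    rw [hβ b.p a.p]
    ring
  · simp only [add_def]
    exact add_comm _ _

theorem gneg_add_cancel (a : GPin β hβ) : -a + a = 0 := by
  ext
  · simp only [add_def, neg_def, zero_def]
    generalize a.w = u
    generalize β a.p a.p = v
    revert u v
    decide
  · simp only [add_def, neg_def, zero_def]
    exact add_self_V _

instance : AddCommGroup (GPin β hβ) where
  add := (· + ·)
  zero := 0
  neg := Neg.neg
  add_assoc := gadd_assoc
  zero_add := gzero_add
  add_zero := gadd_zero
  add_comm := gadd_comm
  neg_add_cancel := gneg_add_cancel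
  nsmul := nsmulRec
  zsmul := zsmulRec

end GPin

/-- A group of exponent two and order `2 ^ m` is elementary abelian of rank `m`. -/
theorem AddCommGroup.nonempty_addEquiv_of_two_torsion {A : Type*} [AddCommGroup A] [Finite A]
    (h : ∀ a : A, 2 • a = 0) {m : ℕ} (hc : Nat.card A = 2 ^ m) :
    Nonempty (A ≃+ (Fin m → ZMod 2)) := by
  let _ : Module (ZMod 2) A := AddCommGroup.zmodModule h
  have hr : Module.finrank (ZMod 2) A = m := by
    have h2 := Module.natCard_eq_pow_finrank (K := ZMod 2) (V := A)
    rw [hc, Nat.card_zmod] at h2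
    exact (Nat.pow_right_injective le_rfl h2).symm
  exact ⟨(LinearEquiv.ofFinrankEq A (Fin m → ZMod 2) (hr.trans (Module.finrank_fin_fun (ZMod 2)).symm)).toAddEquiv⟩

/-- A nonzero element of a group of exponent two is detected by a homomorphism to `ZMod 2`. -/
theorem AddCommGroup.exists_addMonoidHom_eq_one_of_two_torsion {A : Type*} [AddCommGroup A]
    (h : ∀ a : A, 2 • a = 0) {z : A} (hz : z ≠ 0) : ∃ φ : A →+ ZMod 2, φ z = 1 := by
  let _ : Module (ZMod 2) A := AddCommGroup.zmodModule h
  obtain ⟨φ, hφ⟩ := not_forall.1 (mt (Module.forall_dual_apply_eq_zero_iff (ZMod 2) z).1 hz)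
  exact ⟨φ.toAddMonoidHom, Fin.eq_one_of_ne_zero (φ z) hφ⟩

theorem AddMonoidHom.card_eq_two_mul_card_ker {A : Type*} [AddCommGroup A]
    (f : A →+ ZMod 2) {g : A} (hg : f g = 1) : Nat.card A = 2 * Nat.card f.ker := by
  have hs : Function.Surjective f := fun x => by
    obtain rfl | rfl : x = 0 ∨ x = 1 := by revert x; decide
    exacts [⟨0, map_zero f⟩, ⟨g, hg⟩]
  rw [← f.ker.card_mul_index, AddSubgroup.index_ker, AddMonoidHom.range_eq_top.2 hs,
    AddSubgroup.card_top, Nat.card_zmod, mul_comm]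

/-- If the elements of `G` of order dividing two are the kernel of a homomorphism to `ZMod 2`
which is nonzero at an element of order four, then `G` has exactly one cyclic factor of
order four. -/
theorem AddCommGroup.nonempty_addEquiv_zmod_four_prod {G : Type*} [AddCommGroup G] [Finite G]
    (f : G →+ ZMod 2) (hf : ∀ x, f x = 0 → 2 • x = 0) {g : G} (hg : f g = 1)
    (hg2 : 2 • g ≠ 0) {m : ℕ} (hc : Nat.card G = 2 ^ (m + 2)) :
    Nonempty (G ≃+ ZMod 4 × (Fin m → ZMod 2)) := by
  have hK : ∀ a : f.ker, 2 • a = 0 := fun a => Subtype.ext (hf a a.2)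
  have hzf : f (2 • g) = 0 := by rw [map_nsmul, hg]; decide
  obtain ⟨φ, hφ⟩ := AddCommGroup.exists_addMonoidHom_eq_one_of_two_torsion hK
    (z := ⟨2 • g, hzf⟩) (fun h => hg2 (congrArg Subtype.val h))
  have hcC : Nat.card φ.ker = 2 ^ m := by
    have h1 := f.card_eq_two_mul_card_ker hg
    have h2 := φ.card_eq_two_mul_card_ker hφ
    rw [hc, h2, pow_add] at h1
    omega
  obtain ⟨e⟩ := AddCommGroup.nonempty_addEquiv_of_two_torsion
    (fun a : φ.ker => Subtype.ext (hK a)) hcC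
  have hg4 : zmultiplesHom G g (4 : ℕ) = 0 := by
    rw [zmultiplesHom_apply, natCast_zsmul, show 4 = 2 * 2 from rfl, mul_nsmul]
    exact hf _ hzf
  let k : ZMod 4 →+ G := ZMod.lift 4 ⟨zmultiplesHom G g, hg4⟩
  have hk1 : k 1 = g := by
    have := ZMod.lift_coe 4 (⟨zmultiplesHom G g, hg4⟩ : {f : ℤ →+ G // f (4 : ℕ) = 0}) 1
    simpa [k] using this
  let F : ZMod 4 × φ.ker →+ G := k.coprod (f.ker.subtype.comp φ.ker.subtype)
  have hF : Function.Injective F := by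
    rw [injective_iff_map_eq_zero]
    rintro ⟨a, c⟩ h
    have hac : k a + (c : f.ker) = 0 := h
    have hkn : ∀ i : ℕ, k i = i • g := fun i => by rw [← hk1, ← map_nsmul, nsmul_one]
    have hfa : f (k a) = 0 := by
      have := congrArg f hac
      rwa [map_add, (c : f.ker).2, add_zero, map_zero] at this
    have ha : a = 0 ∨ a = 2 := by
      obtain rfl | rfl | rfl | rfl : a = 0 ∨ a = 1 ∨ a = 2 ∨ a = 3 :=
        (by decide : ∀ b : ZMod 4, b = 0 ∨ b = 1 ∨ b = 2 ∨ b = 3) a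
      · exact .inl rfl
      · simp [hk1, hg] at hfa
      · exact .inr rfl
      · have h3 := hkn 3
        rw [show (3 : ZMod 4) = ((3 : ℕ) : ZMod 4) from rfl, h3, map_nsmul, hg] at hfa
        exact absurd hfa (by decide)
    obtain rfl | rfl := ha
    · rw [map_zero, zero_add] at hac
      exact Prod.ext rfl (Subtype.ext (Subtype.ext hac))
    · rw [show (2 : ZMod 4) = ((2 : ℕ) : ZMod 4) from rfl, hkn 2] at hac
      have hsum : (⟨2 • g, hzf⟩ : f.ker) + c = 0 := Subtype.ext hac
      have := congrArg φ hsum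
      rw [map_add, hφ, c.2, map_zero] at this
      exact absurd this (by decide)
  have hcard : Nat.card (ZMod 4 × φ.ker) = Nat.card G := by
    rw [Nat.card_prod, hcC, hc, Nat.card_zmod, pow_add]
    ring
  have hFb := (Nat.bijective_iff_injective_and_card F).2 ⟨hF, hcard⟩
  exact ⟨(AddEquiv.ofBijective F hFb).symm.trans ((AddEquiv.refl _).prodCongr e)⟩

namespace GPin

variable {β : V →ₗ[ZMod 2] V →ₗ[ZMod 2] ZMod 2} {hβ : ∀ x y : V, β x y = β y x}

/-- The set underlying `GPin β hβ`. -/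
def equivProd : GPin β hβ ≃ ZMod 2 × V where
  toFun a := (a.w, a.p)
  invFun a := ⟨a.1, a.2⟩

theorem two_nsmul_eq (a : GPin β hβ) : 2 • a = ⟨β a.p a.p, 0⟩ := by
  rw [two_nsmul]
  ext
  · simp [add_def, CharTwo.add_self_eq_zero]
  · exact add_self_V _

/-- The homomorphism `(w, p) ↦ β p p`. -/
def square : GPin β hβ →+ ZMod 2 where
  toFun a := β a.p a.p
  map_zero' := by simp [zero_def]
  map_add' a b := by
    simp only [add_def, map_add, LinearMap.add_apply]
    rw [hβ b.p a.p]
    linear_combination CharTwo.add_self_eq_zero (β a.p b.p)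

instance [FiniteDimensional (ZMod 2) V] : Finite (GPin β hβ) :=
  have : Finite V := Module.finite_of_finite (ZMod 2)
  Finite.of_equiv _ equivProd.symm

theorem natCard_eq [FiniteDimensional (ZMod 2) V] :
    Nat.card (GPin β hβ) = 2 ^ (Module.finrank (ZMod 2) V + 1) := by
  rw [Nat.card_congr equivProd, Nat.card_prod, Module.natCard_eq_pow_finrank (K := ZMod 2) (V := V),
    Nat.card_zmod, pow_succ']

end GPin

/-- Abstract form of §6.5 of the paper: for `V` of dimension `n` over `ZMod 2`,
if `β x₀ x₀ = 1` for some `x₀` then `G_β ≅ ZMod 4 × (ZMod 2)^(n-1)`, while if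
`β x x = 0` for all `x` then every element of `G_β` has order dividing 2 and
`G_β ≅ (ZMod 2)^(n+1)`. -/
theorem GPin_structure_theorem
    (β : V →ₗ[ZMod 2] V →ₗ[ZMod 2] ZMod 2) (hβ : ∀ x y : V, β x y = β y x)
    (n : ℕ) [FiniteDimensional (ZMod 2) V]
    (hn : Module.finrank (ZMod 2) V = n) :
    ((∃ x₀ : V, β x₀ x₀ = 1) →
      Nonempty (GPin β hβ ≃+ ZMod 4 × (Fin (n - 1) → ZMod 2))) ∧
    ((∀ x : V, β x x = 0) →
      (∀ g : GPin β hβ, addOrderOf g ∣ 2) ∧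
      Nonempty (GPin β hβ ≃+ (Fin (n + 1) → ZMod 2))) := by
  subst hn
  constructor
  · rintro ⟨x₀, hx₀⟩
    have : Nontrivial V := ⟨x₀, 0, by rintro rfl; simp at hx₀⟩
    have hpos : 0 < Module.finrank (ZMod 2) V := Module.finrank_pos
    refine AddCommGroup.nonempty_addEquiv_zmod_four_prod GPin.square (g := ⟨0, x₀⟩)
      (fun a ha => ?_) hx₀ (fun h => ?_) ?_
    · rw [GPin.two_nsmul_eq, show β a.p a.p = 0 from ha, GPin.zero_def]
    · rw [GPin.two_nsmul_eq, GPin.zero_def, GPin.mk.injEq, hx₀] at h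
      exact one_ne_zero h.1
    · rw [GPin.natCard_eq]
      congr 1
      omega
  · intro h
    have h2 : ∀ a : GPin β hβ, 2 • a = 0 := fun a => by
      rw [GPin.two_nsmul_eq, h, GPin.zero_def]
    exact ⟨fun g => addOrderOf_dvd_of_nsmul_eq_zero (h2 g),
      AddCommGroup.nonempty_addEquiv_of_two_torsion h2 GPin.natCard_eq⟩
end
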